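/- Under the stated conditions, E| ∑_{l=0}^∞ c_{n,l}² V_l − σ² E(V_0) | → 0 as n → ∞; in particular ∑_{l=0}^∞ c_{n,l}² V_l → σ² E(V_0) in L¹. -/

import Mathlib

open MeasureTheory Filter Real Topology

section Series

variable {Ω : Type*} [MeasurableSpace Ω] {μ : Measure Ω} {F : ℕ → Ω → ℝ}

lemma ae_summable_norm_of_summable_integral_norm (hF : ∀ i, Integrable (F i) μ)
    (hs : Summable fun i => ∫ x, ‖F i x‖ ∂μ) : ∀ᵐ x ∂μ, Summable fun i => ‖F i x‖ := by
  have hne : ∫⁻ x, ∑' i, ENNReal.ofReal ‖F i x‖ ∂μ ≠ ⊤ := by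
    rw [lintegral_tsum fun i => (hF i).norm.aemeasurable.ennreal_ofReal]
    have h (i : ℕ) : ∫⁻ x, ENNReal.ofReal ‖F i x‖ ∂μ = ENNReal.ofReal (∫ x, ‖F i x‖ ∂μ) :=
      (ofReal_integral_eq_lintegral_ofReal (hF i).norm (ae_of_all _ fun _ => norm_nonneg _)).symm
    simp_rw [h]
    exact hs.tsum_ofReal_ne_top
  filter_upwards [ae_lt_top' (AEMeasurable.tsum
    fun i => (hF i).norm.aemeasurable.ennreal_ofReal) hne] with x hx
  have := ENNReal.summable_toReal hx.ne
  simpa using this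

lemma integrable_tsum_of_summable_integral_norm (hF : ∀ i, Integrable (F i) μ)
    (hs : Summable fun i => ∫ x, ‖F i x‖ ∂μ) : Integrable (fun x => ∑' i, F i x) μ := by
  have hae := ae_summable_norm_of_summable_integral_norm hF hs
  refine ⟨?_, ?_⟩
  · refine aestronglyMeasurable_of_tendsto_ae (u := atTop)
      (f := fun (n : ℕ) x => ∑ i ∈ Finset.range n, F i x) ?_ ?_
    · intro n
      exact (integrable_finsetSum _ fun i _ => hF i).aestronglyMeasurable
    · filter_upwards [hae] with x hx
      exact hx.of_norm.hasSum.tendsto_sum_nat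
  · have h (i : ℕ) : ∫⁻ x, ‖F i x‖ₑ ∂μ = ENNReal.ofReal (∫ x, ‖F i x‖ ∂μ) :=
      (ofReal_integral_norm_eq_lintegral_enorm (hF i)).symm
    calc ∫⁻ x, ‖∑' i, F i x‖ₑ ∂μ
        ≤ ∫⁻ x, ∑' i, ‖F i x‖ₑ ∂μ := by
          refine lintegral_mono_ae ?_
          filter_upwards [hae] with x hx
          exact enorm_tsum_le_tsum_enorm
      _ = ∑' i, ENNReal.ofReal (∫ x, ‖F i x‖ ∂μ) := by
          rw [lintegral_tsum fun i => (hF i).aestronglyMeasurable.enorm]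
          simp_rw [h]
      _ < ⊤ := hs.tsum_ofReal_lt_top

lemma integral_abs_tsum_le (hF : ∀ i, Integrable (F i) μ)
    (hs : Summable fun i => ∫ x, ‖F i x‖ ∂μ) :
    ∫ x, |∑' i, F i x| ∂μ ≤ ∑' i, ∫ x, |F i x| ∂μ := by
  have hs' : Summable fun i => ∫ x, ‖‖F i x‖‖ ∂μ := by simpa only [norm_norm] using hs
  have h1 := integral_tsum_of_summable_integral_norm (fun i => (hF i).norm) hs'
  simp only [Real.norm_eq_abs] at h1
  rw [h1]
  refine integral_mono_ae (integrable_tsum_of_summable_integral_norm hF hs).abs ?_ ?_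
  · simpa only [Real.norm_eq_abs] using
      integrable_tsum_of_summable_integral_norm (fun i => (hF i).norm) hs'
  · filter_upwards [ae_summable_norm_of_summable_integral_norm hF hs] with x hx
    simpa only [Real.norm_eq_abs] using norm_tsum_le_tsum_norm hx

end Series

section Stationary

variable {Ω : Type*} [MeasurableSpace Ω] {P : Measure Ω} {T : Ω → Ω}

lemma MeasureTheory.MeasurePreserving.integral_comp_of_aestronglyMeasurable
    (hT : MeasurePreserving T P P) {f : Ω → ℝ} (hf : AEStronglyMeasurable f P) :
    ∫ x, f (T x) ∂P = ∫ x, f x ∂P := by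
  have h := integral_map (μ := P) (φ := T) (f := f) hT.measurable.aemeasurable
    (by rwa [hT.map_eq])
  rw [hT.map_eq] at h
  exact h.symm

lemma integrable_iterate (hT : MeasurePreserving T P P) {f : Ω → ℝ} (hf : Integrable f P)
    (l : ℕ) : Integrable (fun x => f (T^[l] x)) P :=
  (hT.iterate l).integrable_comp_of_integrable hf

lemma integral_norm_weighted_iterate (hT : MeasurePreserving T P P) {f : Ω → ℝ}
    (hf : Integrable f P) {a : ℕ → ℝ} (ha : ∀ l, 0 ≤ a l) (l : ℕ) :
    ∫ x, ‖a l * f (T^[l] x)‖ ∂P = a l * ∫ x, |f x| ∂P := by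
  simp_rw [norm_mul, Real.norm_eq_abs, abs_of_nonneg (ha l)]
  rw [integral_const_mul, (hT.iterate l).integral_comp_of_aestronglyMeasurable
    (f := fun x => |f x|) hf.abs.aestronglyMeasurable]

lemma summable_integral_norm_weighted_iterate (hT : MeasurePreserving T P P) {f : Ω → ℝ}
    (hf : Integrable f P) {a : ℕ → ℝ} (ha : ∀ l, 0 ≤ a l) (hs : Summable a) :
    Summable fun l => ∫ x, ‖a l * f (T^[l] x)‖ ∂P := by
  simp_rw [integral_norm_weighted_iterate hT hf ha]
  exact hs.mul_right _

lemma integral_abs_tsum_weighted_iterate_le (hT : MeasurePreserving T P P) {f : Ω → ℝ}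
    (hf : Integrable f P) {a : ℕ → ℝ} (ha : ∀ l, 0 ≤ a l) (hs : Summable a) :
    ∫ x, |∑' l, a l * f (T^[l] x)| ∂P ≤ (∑' l, a l) * ∫ x, |f x| ∂P := by
  refine (integral_abs_tsum_le (fun l => (integrable_iterate hT hf l).const_mul _)
    (summable_integral_norm_weighted_iterate hT hf ha hs)).trans_eq ?_
  simp_rw [← Real.norm_eq_abs (_ * _), integral_norm_weighted_iterate hT hf ha]
  exact tsum_mul_right

lemma integral_iterate_mul_iterate (hT : MeasurePreserving T P P) {g : Ω → ℝ}
    (hg : AEStronglyMeasurable g P) {l m : ℕ} (h : l ≤ m) :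
    ∫ x, g (T^[l] x) * g (T^[m] x) ∂P = ∫ x, g x * g (T^[m - l] x) ∂P := by
  rw [← (hT.iterate l).integral_comp_of_aestronglyMeasurable
    (f := fun x => g x * g (T^[m - l] x))
    (hg.mul (hg.comp_measurePreserving (hT.iterate (m - l))))]
  simp_rw [← Function.iterate_add_apply, Nat.sub_add_cancel h]

variable [IsProbabilityMeasure P]

lemma sq_integral_abs_le_integral_sq {S : Ω → ℝ} (hS : Integrable S P)
    (hS2 : Integrable (fun x => S x ^ 2) P) :
    (∫ x, |S x| ∂P) ^ 2 ≤ ∫ x, S x ^ 2 ∂P := by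
  set m := ∫ x, |S x| ∂P with hm
  have h0 : 0 ≤ ∫ x, (|S x| - m) ^ 2 ∂P := integral_nonneg fun x => sq_nonneg _
  have h1 : ∫ x, (|S x| - m) ^ 2 ∂P = ∫ x, (S x ^ 2 - 2 * m * |S x| + m ^ 2) ∂P := by
    refine integral_congr_ae (ae_of_all _ fun x => ?_)
    have := sq_abs (S x)
    simp only
    linear_combination this
  have h2 : Integrable (fun x => S x ^ 2 - 2 * m * |S x|) P := hS2.sub (hS.abs.const_mul _)
  rw [h1, integral_add h2 (integrable_const _), integral_sub hS2 (hS.abs.const_mul _), integral_const_mul, ← hm] at h0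
  simp at h0
  nlinarith

lemma abs_integral_iterate_mul_iterate_le (hT : MeasurePreserving T P P) {g : Ω → ℝ}
    (hg : AEStronglyMeasurable g P) {M ε : ℝ} (hε : 0 ≤ ε) (hM : ∀ x, |g x| ≤ M) {K : ℕ}
    (hK : ∀ k ≥ K, |∫ x, g x * g (T^[k] x) ∂P| ≤ ε) (l m : ℕ) :
    |∫ x, g (T^[l] x) * g (T^[m] x) ∂P| ≤
      ε + if l < m + K ∧ m < l + K then M ^ 2 else 0 := by
  split_ifs with h
  · have : ‖∫ x, g (T^[l] x) * g (T^[m] x) ∂P‖ ≤ M ^ 2 * P.real Set.univ := by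
      refine norm_integral_le_of_norm_le_const (ae_of_all _ fun x => ?_)
      rw [norm_mul, sq]
      exact mul_le_mul (hM _) (hM _) (norm_nonneg _) ((abs_nonneg _).trans (hM x))
    simp only [Real.norm_eq_abs, probReal_univ, mul_one] at this
    linarith
  · rw [add_zero]
    rcases le_total l m with hlm | hlm
    · rw [integral_iterate_mul_iterate hT hg hlm]
      exact hK _ (by grind)
    · simp_rw [mul_comm (g (T^[l] _))]
      rw [integral_iterate_mul_iterate hT hg hlm]
      exact hK _ (by grind)

lemma sum_near_le {a : ℕ → ℝ} {b : ℝ} (ha : ∀ l, 0 ≤ a l) (hb : ∀ l, a l ≤ b) (N K l : ℕ) :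
    ∑ m ∈ Finset.range N, (if l < m + K ∧ m < l + K then a m else 0) ≤ 2 * K * b := by
  have hb0 : 0 ≤ b := (ha 0).trans (hb 0)
  rw [← Finset.sum_filter]
  refine (Finset.sum_le_card_nsmul _ _ b fun m _ => hb m).trans ?_
  rw [nsmul_eq_mul]
  refine mul_le_mul_of_nonneg_right ?_ hb0
  have hsub : (Finset.range N).filter (fun m => l < m + K ∧ m < l + K) ⊆
      Finset.Ico (l - K) (l + K) := by
    intro m hm
    simp only [Finset.mem_filter, Finset.mem_Ico] at hm ⊢
    lia
  have hcard := Finset.card_le_card hsub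
  rw [Nat.card_Ico] at hcard
  have : ((Finset.range N).filter (fun m => l < m + K ∧ m < l + K)).card ≤ 2 * K := by lia
  exact_mod_cast this

lemma sum_mul_near_le {a : ℕ → ℝ} {b ε M A : ℝ} (ha : ∀ l, 0 ≤ a l) (hb : ∀ l, a l ≤ b)
    (hε : 0 ≤ ε) {N : ℕ} (hA : ∑ l ∈ Finset.range N, a l ≤ A) (K : ℕ) :
    ∑ l ∈ Finset.range N, ∑ m ∈ Finset.range N,
      a l * a m * (ε + if l < m + K ∧ m < l + K then M ^ 2 else 0) ≤
      ε * A ^ 2 + 2 * K * b * M ^ 2 * A := by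
  have hb0 : 0 ≤ b := (ha 0).trans (hb 0)
  have hS0 : 0 ≤ ∑ l ∈ Finset.range N, a l := Finset.sum_nonneg fun l _ => ha l
  have h (l : ℕ) : ∑ m ∈ Finset.range N,
      a l * a m * (ε + if l < m + K ∧ m < l + K then M ^ 2 else 0) ≤
      a l * (ε * A + 2 * K * b * M ^ 2) := by
    have e : ∑ m ∈ Finset.range N,
        a l * a m * (ε + if l < m + K ∧ m < l + K then M ^ 2 else 0) =
        a l * (ε * ∑ m ∈ Finset.range N, a m +
          (∑ m ∈ Finset.range N, (if l < m + K ∧ m < l + K then a m else 0)) * M ^ 2) := by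
      rw [Finset.mul_sum, Finset.sum_mul, ← Finset.sum_add_distrib, Finset.mul_sum]
      refine Finset.sum_congr rfl fun m _ => ?_
      split_ifs <;> ring
    rw [e]
    refine mul_le_mul_of_nonneg_left ?_ (ha l)
    gcongr
    exact sum_near_le ha hb N K l
  refine (Finset.sum_le_sum fun l _ => h l).trans ?_
  rw [← Finset.sum_mul]
  have hA0 : 0 ≤ A := hS0.trans hA
  have : 0 ≤ ε * A + 2 * K * b * M ^ 2 := by positivity
  nlinarith [mul_le_mul_of_nonneg_right hA this]

lemma sq_integral_abs_sum_weighted_iterate_le (hT : MeasurePreserving T P P) {g : Ω → ℝ}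
    (hg : AEStronglyMeasurable g P) {M ε : ℝ} (hε : 0 ≤ ε) (hM : ∀ x, |g x| ≤ M) {K : ℕ}
    (hK : ∀ k ≥ K, |∫ x, g x * g (T^[k] x) ∂P| ≤ ε) {a : ℕ → ℝ} {b A : ℝ}
    (ha : ∀ l, 0 ≤ a l) (hb : ∀ l, a l ≤ b) {N : ℕ} (hA : ∑ l ∈ Finset.range N, a l ≤ A) :
    (∫ x, |∑ l ∈ Finset.range N, a l * g (T^[l] x)| ∂P) ^ 2 ≤
      ε * A ^ 2 + 2 * K * b * M ^ 2 * A := by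
  have hgi : Integrable g P := Integrable.of_bound hg M (ae_of_all _ hM)
  have hgg (l m : ℕ) : Integrable (fun x => g (T^[l] x) * g (T^[m] x)) P :=
    (integrable_iterate hT hgi m).bdd_mul
      (integrable_iterate hT hgi l).aestronglyMeasurable (c := M) (ae_of_all _ fun x => hM _)
  have hsq (x : Ω) : (∑ l ∈ Finset.range N, a l * g (T^[l] x)) ^ 2 =
      ∑ l ∈ Finset.range N, ∑ m ∈ Finset.range N,
        a l * a m * (g (T^[l] x) * g (T^[m] x)) := by
    rw [sq, Finset.sum_mul_sum]
    exact Finset.sum_congr rfl fun l _ => Finset.sum_congr rfl fun m _ => by ring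
  have hi (l m : ℕ) : Integrable (fun x => a l * a m * (g (T^[l] x) * g (T^[m] x))) P :=
    (hgg l m).const_mul _
  refine (sq_integral_abs_le_integral_sq
    (integrable_finsetSum _ fun l _ => (integrable_iterate hT hgi l).const_mul _) ?_).trans ?_
  · simp_rw [hsq]
    exact integrable_finsetSum _ fun l _ => integrable_finsetSum _ fun m _ => hi l m
  · simp_rw [hsq]
    rw [integral_finsetSum _ fun l _ => integrable_finsetSum _ fun m _ => hi l m]
    refine le_trans (Finset.sum_le_sum fun l _ => ?_) (sum_mul_near_le ha hb hε hA K)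
    rw [integral_finsetSum _ fun m _ => hi l m]
    refine Finset.sum_le_sum fun m _ => ?_
    rw [integral_const_mul]
    exact mul_le_mul_of_nonneg_left ((le_abs_self _).trans
      (abs_integral_iterate_mul_iterate_le hT hg hε hM hK l m)) (mul_nonneg (ha l) (ha m))

lemma sq_integral_abs_tsum_weighted_iterate_le (hT : MeasurePreserving T P P) {g : Ω → ℝ}
    (hg : AEStronglyMeasurable g P) {M ε : ℝ} (hε : 0 ≤ ε) (hM : ∀ x, |g x| ≤ M) {K : ℕ}
    (hK : ∀ k ≥ K, |∫ x, g x * g (T^[k] x) ∂P| ≤ ε) {a : ℕ → ℝ} {b : ℝ}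
    (ha : ∀ l, 0 ≤ a l) (hb : ∀ l, a l ≤ b) (hs : Summable a) :
    (∫ x, |∑' l, a l * g (T^[l] x)| ∂P) ^ 2 ≤
      ε * (∑' l, a l) ^ 2 + 2 * K * b * M ^ 2 * ∑' l, a l := by
  have hgi : Integrable g P := Integrable.of_bound hg M (ae_of_all _ hM)
  have hpt (x : Ω) (l : ℕ) : ‖a l * g (T^[l] x)‖ ≤ a l * M := by
    rw [norm_mul, Real.norm_of_nonneg (ha l)]
    exact mul_le_mul_of_nonneg_left (hM _) (ha l)
  have hlim : Tendsto (fun N => ∫ x, |∑ l ∈ Finset.range N, a l * g (T^[l] x)| ∂P) atTop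
      (𝓝 (∫ x, |∑' l, a l * g (T^[l] x)| ∂P)) := by
    refine tendsto_integral_of_dominated_convergence (fun _ => ∑' l, a l * M) ?_
      (integrable_const _) ?_ ?_
    · intro N
      exact (integrable_finsetSum _ fun l _ =>
        (integrable_iterate hT hgi l).const_mul _).abs.aestronglyMeasurable
    · refine fun N => ae_of_all _ fun x => ?_
      rw [Real.norm_eq_abs, abs_abs, ← Real.norm_eq_abs]
      refine (norm_sum_le_of_le _ fun l _ => hpt x l).trans ?_
      exact (hs.mul_right M).sum_le_tsum _
        fun l _ => (norm_nonneg _).trans (hpt x l)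
    · refine ae_of_all _ fun x => ?_
      exact ((hs.mul_right M).of_norm_bounded (hpt x)).hasSum.tendsto_sum_nat.abs
  exact le_of_tendsto' (hlim.pow 2) fun N =>
    sq_integral_abs_sum_weighted_iterate_le hT hg hε hM hK ha hb
      (hs.sum_le_tsum _ fun l _ => ha l)

/-- Weighted sums of a bounded stationary sequence with vanishing correlations tend to `0` in `L¹`
when the weights are uniformly small and have bounded total mass. -/
lemma tendsto_integral_abs_tsum_weighted_iterate (hT : MeasurePreserving T P P) {g : Ω → ℝ}
    (hg : AEStronglyMeasurable g P) {M : ℝ} (hM : ∀ x, |g x| ≤ M)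
    (hr : Tendsto (fun k => ∫ x, g x * g (T^[k] x) ∂P) atTop (𝓝 0))
    {a : ℕ → ℕ → ℝ} {b : ℕ → ℝ} {A : ℝ} (ha : ∀ n l, 0 ≤ a n l) (hb : ∀ n l, a n l ≤ b n)
    (hs : ∀ n, Summable (a n)) (hA : Tendsto (fun n => ∑' l, a n l) atTop (𝓝 A))
    (hb0 : Tendsto b atTop (𝓝 0)) :
    Tendsto (fun n => ∫ x, |∑' l, a n l * g (T^[l] x)| ∂P) atTop (𝓝 0) := by
  suffices h : Tendsto (fun n => (∫ x, |∑' l, a n l * g (T^[l] x)| ∂P) ^ 2) atTop (𝓝 0) by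
    have h2 := h.sqrt
    rw [Real.sqrt_zero] at h2
    refine h2.congr fun n => Real.sqrt_sq (integral_nonneg fun x => abs_nonneg _)
  refine tendsto_order.2 ⟨fun y hy => Eventually.of_forall fun n => hy.trans_le (sq_nonneg _),
    fun δ hδ => ?_⟩
  obtain ⟨ε, hε, hεδ⟩ : ∃ ε > 0, ε * A ^ 2 < δ :=
    ⟨δ / (A ^ 2 + 1), by positivity, by
      rw [div_mul_eq_mul_div, div_lt_iff₀ (by positivity)]; nlinarith⟩
  obtain ⟨K, hK⟩ := Metric.tendsto_atTop.1 hr ε hε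
  have hlim : Tendsto (fun n => ε * (∑' l, a n l) ^ 2 + 2 * K * b n * M ^ 2 * ∑' l, a n l) atTop
      (𝓝 (ε * A ^ 2 + 2 * K * 0 * M ^ 2 * A)) :=
    ((hA.pow 2).const_mul ε).add (((hb0.const_mul _).mul_const _).mul hA)
  filter_upwards [hlim.eventually_lt_const (u := δ) (by simpa using hεδ)] with n hn
  refine (sq_integral_abs_tsum_weighted_iterate_le hT hg hε.le hM (fun k hk => ?_)
    (ha n) (hb n) (hs n)).trans_lt hn
  have := hK k hk
  rw [Real.dist_eq, sub_zero] at this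
  exact this.le

lemma integral_centered_mul_centered_iterate (hT : MeasurePreserving T P P) {f : Ω → ℝ}
    (hf : Integrable f P) {M : ℝ} (hM : ∀ x, |f x| ≤ M) (k : ℕ) :
    ∫ x, (f x - ∫ y, f y ∂P) * (f (T^[k] x) - ∫ y, f y ∂P) ∂P =
      (∫ x, f x * f (T^[k] x) ∂P) - (∫ x, f x ∂P) * ∫ x, f (T^[k] x) ∂P := by
  have hk := integrable_iterate hT hf k
  have hkk : ∫ x, f (T^[k] x) ∂P = ∫ x, f x ∂P :=
    (hT.iterate k).integral_comp_of_aestronglyMeasurable hf.aestronglyMeasurable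
  have hff : Integrable (fun x => f x * f (T^[k] x)) P :=
    hk.bdd_mul hf.aestronglyMeasurable (c := M) (ae_of_all _ hM)
  set e := ∫ x, f x ∂P with he
  have h1 (x : Ω) : (f x - e) * (f (T^[k] x) - e) =
      f x * f (T^[k] x) - e * f (T^[k] x) - e * f x + e * e := by ring
  simp_rw [h1]
  have h2 : Integrable (fun x => f x * f (T^[k] x) - e * f (T^[k] x)) P :=
    hff.sub (hk.const_mul e)
  have h3 : Integrable (fun x => f x * f (T^[k] x) - e * f (T^[k] x) - e * f x) P :=
    h2.sub (hf.const_mul e)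
  rw [integral_add h3 (integrable_const _), integral_sub h2 (hf.const_mul e),
    integral_sub hff (hk.const_mul e), integral_const_mul, integral_const_mul, hkk, ← he]
  simp

end Stationary

lemma tendsto_integral_abs_sub_truncation {Ω : Type*} [MeasurableSpace Ω] {P : Measure Ω}
    {V : Ω → ℝ} (hV : Integrable V P)
    (hf : ∀ w : ℝ, AEStronglyMeasurable (fun x => if V x ≤ w then V x else 0) P) :
    Tendsto (fun w : ℝ => ∫ x, |V x - if V x ≤ w then V x else 0| ∂P) atTop (𝓝 0) := by
  suffices h : Tendsto (fun w : ℝ => ∫ x, |V x - if V x ≤ w then V x else 0| ∂P) atTop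
      (𝓝 (∫ _, (0 : ℝ) ∂P)) by rwa [integral_zero] at h
  refine tendsto_integral_filter_of_dominated_convergence (fun x => |V x|) ?_ ?_ hV.abs ?_
  · exact Eventually.of_forall fun w => (hV.aestronglyMeasurable.sub (hf w)).norm
  · refine Eventually.of_forall fun w => ae_of_all _ fun x => ?_
    split_ifs <;> simp
  · refine ae_of_all _ fun x => tendsto_const_nhds.congr' ?_
    filter_upwards [eventually_ge_atTop (V x)] with w hw
    simp [hw]

lemma aestronglyMeasurable_truncation {Ω : Type*} [MeasurableSpace Ω] {P : Measure Ω}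
    {V : Ω → ℝ} (hV : AEStronglyMeasurable V P) (w : ℝ) :
    AEStronglyMeasurable (fun x => if V x ≤ w then V x else 0) P := by
  have hm : Measurable fun y : ℝ => if y ≤ w then y else 0 :=
    Measurable.ite measurableSet_Iic measurable_id measurable_const
  exact (hm.comp_aemeasurable hV.aemeasurable).aestronglyMeasurable

lemma integral_abs_tsum_sub_le {Ω : Type*} [MeasurableSpace Ω] {P : Measure Ω}
    [IsProbabilityMeasure P] {T : Ω → Ω} (hT : MeasurePreserving T P P) {V f : Ω → ℝ}
    (hV : Integrable V P) (hf : Integrable f P) {a : ℕ → ℝ} (ha : ∀ l, 0 ≤ a l)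
    (hs : Summable a) (s : ℝ) :
    ∫ x, |(∑' l, a l * V (T^[l] x)) - s * ∫ y, V y ∂P| ∂P ≤
      (∫ x, |∑' l, a l * (f (T^[l] x) - ∫ y, f y ∂P)| ∂P) +
        (∑' l, a l) * (2 * ∫ x, |V x - f x| ∂P) + |((∑' l, a l) - s) * ∫ y, V y ∂P| := by
  set e := ∫ y, V y ∂P with he
  set d := ∫ y, f y ∂P with hd
  have hg : Integrable (fun x => f x - d) P := hf.sub (integrable_const _)
  have hVf : Integrable (fun x => V x - f x) P := hV.sub hf
  have hh : Integrable (fun x => V x - f x - (e - d)) P := hVf.sub (integrable_const _)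
  have hgl (l : ℕ) : Integrable (fun x => a l * (f (T^[l] x) - d)) P :=
    (integrable_iterate hT hg l).const_mul _
  have hhl (l : ℕ) : Integrable (fun x => a l * (V (T^[l] x) - f (T^[l] x) - (e - d))) P :=
    (integrable_iterate hT hh l).const_mul _
  have hgs := summable_integral_norm_weighted_iterate hT hg ha hs
  have hhs := summable_integral_norm_weighted_iterate hT hh ha hs
  have hGi := (integrable_tsum_of_summable_integral_norm hgl hgs).abs
  have hHi := (integrable_tsum_of_summable_integral_norm hhl hhs).abs
  have hhe : ∫ x, |V x - f x - (e - d)| ∂P ≤ 2 * ∫ x, |V x - f x| ∂P := by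
    have hed : |e - d| ≤ ∫ x, |V x - f x| ∂P := by
      rw [he, hd, ← integral_sub hV hf]
      exact abs_integral_le_integral_abs
    calc ∫ x, |V x - f x - (e - d)| ∂P ≤ ∫ x, (|V x - f x| + |e - d|) ∂P :=
          integral_mono hh.abs (hVf.abs.add (integrable_const _)) fun x => abs_sub _ _
      _ = (∫ x, |V x - f x| ∂P) + |e - d| := by
          rw [integral_add hVf.abs (integrable_const _)]; simp
      _ ≤ _ := by linarith
  calc _ ≤ ∫ x, (|∑' l, a l * (f (T^[l] x) - d)| +
        |∑' l, a l * (V (T^[l] x) - f (T^[l] x) - (e - d))| + |((∑' l, a l) - s) * e|) ∂P := by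
        refine integral_mono_of_nonneg (ae_of_all _ fun x => abs_nonneg _)
          ((hGi.add hHi).add (integrable_const _)) ?_
        filter_upwards [ae_summable_norm_of_summable_integral_norm hgl hgs,
          ae_summable_norm_of_summable_integral_norm hhl hhs] with x hx hy
        have hsum := (hx.of_norm.hasSum.add hy.of_norm.hasSum).add (hs.hasSum.mul_right e)
        have hterm (l : ℕ) : a l * (f (T^[l] x) - d) +
            a l * (V (T^[l] x) - f (T^[l] x) - (e - d)) + a l * e = a l * V (T^[l] x) := by
          ring
        simp only [hterm] at hsum
        rw [hsum.tsum_eq, add_sub_assoc, ← sub_mul]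
        exact abs_add_three _ _ _
    _ = (∫ x, |∑' l, a l * (f (T^[l] x) - d)| ∂P) +
        (∫ x, |∑' l, a l * (V (T^[l] x) - f (T^[l] x) - (e - d))| ∂P) +
          |((∑' l, a l) - s) * e| := by
        have hGHi : Integrable (fun x => |∑' l, a l * (f (T^[l] x) - d)| +
            |∑' l, a l * (V (T^[l] x) - f (T^[l] x) - (e - d))|) P := hGi.add hHi
        rw [integral_add hGHi (integrable_const _), integral_add hGi hHi]
        simp
    _ ≤ _ := by
        gcongr
        exact (integral_abs_tsum_weighted_iterate_le hT hh ha hs).trans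
          (mul_le_mul_of_nonneg_left hhe (tsum_nonneg ha))

/-- `E| ∑_l c_{n,l}² V_l − σ² E(V_0) | → 0`, i.e.
`∑_l c_{n,l}² V_l → σ² E(V_0)` in `L¹`. -/
theorem stmt_10
    {Ω : Type*} [MeasurableSpace Ω] (P : Measure Ω) [IsProbabilityMeasure P]
    -- a measure-preserving map generating the stationary sequence V_l = V ∘ T^l
    (T : Ω → Ω) (hT : MeasurePreserving T P P)
    (V : Ω → ℝ) (hV : Integrable V P) (hVnonneg : ∀ ω, 0 ≤ V ω)
    -- for every ω > 0 the truncated covariances vanish at infinity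
    (hcov : ∀ w : ℝ, 0 < w →
      Tendsto (fun k : ℕ =>
          (∫ x, (if V x ≤ w then V x else 0) * (if V (T^[k] x) ≤ w then V (T^[k] x) else 0) ∂P)
            - (∫ x, (if V x ≤ w then V x else 0) ∂P) *
                (∫ x, (if V (T^[k] x) ≤ w then V (T^[k] x) else 0) ∂P))
        atTop (𝓝 0))
    -- the coefficients: ∑_l c_{n,l}² → σ² < ∞ and sup_l |c_{n,l}| → 0
    (c : ℕ → ℕ → ℝ) (σ2 : ℝ)
    (hcsum : ∀ n : ℕ, Summable fun l : ℕ => (c n l) ^ 2)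
    (hc1 : Tendsto (fun n : ℕ => ∑' l : ℕ, (c n l) ^ 2) atTop (𝓝 σ2))
    (hc2 : Tendsto (fun n : ℕ => ⨆ l : ℕ, |c n l|) atTop (𝓝 0)) :
    -- conclusion: L¹ convergence of ∑_l c_{n,l}² V_l to σ² E(V_0)
    Tendsto (fun n : ℕ =>
        ∫ ω, |(∑' l : ℕ, (c n l) ^ 2 * V (T^[l] ω)) - σ2 * ∫ x, V x ∂P| ∂P)
      atTop (𝓝 0) := by
  have ha (n l : ℕ) : 0 ≤ (c n l) ^ 2 := sq_nonneg _
  have hb (n l : ℕ) : (c n l) ^ 2 ≤ (⨆ l : ℕ, |c n l|) ^ 2 := by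
    have hbdd : BddAbove (Set.range fun l => |c n l|) := by
      refine ⟨√(∑' l, (c n l) ^ 2), ?_⟩
      rintro _ ⟨l, rfl⟩
      exact Real.abs_le_sqrt ((hcsum n).le_tsum l fun j _ => sq_nonneg _)
    rw [← sq_abs]
    exact pow_le_pow_left₀ (abs_nonneg _) (le_ciSup hbdd l) 2
  have hb0 : Tendsto (fun n => (⨆ l : ℕ, |c n l|) ^ 2) atTop (𝓝 0) := by
    simpa using hc2.pow 2
  have hfm := aestronglyMeasurable_truncation hV.aestronglyMeasurable
  refine tendsto_order.2 ⟨fun y hy => Eventually.of_forall fun n =>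
    hy.trans_le (integral_nonneg fun x => abs_nonneg _), fun δ hδ => ?_⟩
  have htr := ((tendsto_integral_abs_sub_truncation hV hfm).const_mul 2).const_mul σ2
  rw [mul_zero, mul_zero] at htr
  obtain ⟨w, hw, hw0⟩ := ((htr.eventually_lt_const hδ).and (eventually_gt_atTop 0)).exists
  set f : Ω → ℝ := fun x => if V x ≤ w then V x else 0 with hf
  have hfM (x : Ω) : |f x| ≤ w := by
    simp only [hf]
    split_ifs with h
    · rwa [abs_of_nonneg (hVnonneg x)]
    · simpa using hw0.le
  have hfi : Integrable f P := Integrable.of_bound (hfm w) w (ae_of_all _ hfM)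
  have hr := (hcov w hw0).congr fun k =>
    (integral_centered_mul_centered_iterate hT hfi hfM k).symm
  have hg := tendsto_integral_abs_tsum_weighted_iterate hT
    (hfi.sub (integrable_const (∫ y, f y ∂P))).aestronglyMeasurable
    (fun x => (abs_sub (f x) (∫ y, f y ∂P)).trans (add_le_add_left (hfM x) _))
    hr ha hb hcsum hc1 hb0
  have hlim := (hg.add (hc1.mul_const (2 * ∫ x, |V x - f x| ∂P))).add
    ((hc1.sub_const σ2).mul_const (∫ y, V y ∂P)).abs
  rw [sub_self, zero_mul, abs_zero, add_zero, zero_add] at hlim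
  filter_upwards [hlim.eventually_lt_const hw] with n hn
  exact (integral_abs_tsum_sub_le hT hV hfi (ha n) (hcsum n) σ2).trans_lt hn
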